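/- Fix d ≥ 2, a ∈ ℝ and c₁ ≥ 3. There exists a constant κ > 0 independent of ε such that for every accuracy ε > 0, every positive integer n < κ/ε^{(d−1)/2}, and every deterministic algorithm A, there exists a convex c₁-gradient-Lipschitz function f : [0,1]^d → ℝ whose level set {f = a} is (1/4)-proper such that the output S_n of A run on f after n queries is not an ε-approximation of {f = a}. -/

import Mathlib

noncomputable section

def unitCube (d : ℕ) : Set (Fin d → ℝ) := Set.Icc 0 1

/-- A deterministic sequential algorithm. -/
structure Algorithm (d : ℕ) where
  query : (n : ℕ) → (Fin n → ℝ) → (Fin d → ℝ)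
  query_mem : ∀ n h, query n h ∈ unitCube d
  output : (n : ℕ) → (Fin n → ℝ) → Set (Fin d → ℝ)
  output_sub : ∀ n h, output n h ⊆ unitCube d

/-- The `(n+1)`-st query point of algorithm `A` run on `f`. -/
noncomputable def Algorithm.point {d : ℕ} (A : Algorithm d) (f : (Fin d → ℝ) → ℝ) :
    ℕ → (Fin d → ℝ)
  | n => A.query n fun i : Fin n => f (Algorithm.point A f i)
termination_by n => n
decreasing_by exact i.isLt

/-- The output set of algorithm `A` run on `f` after `n` queries. -/
def Algorithm.outputAfter {d : ℕ} (A : Algorithm d) (f : (Fin d → ℝ) → ℝ) (n : ℕ) :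
    Set (Fin d → ℝ) :=
  A.output n fun i : Fin n => f (A.point f i)

def IsEpsApprox (d : ℕ) (f : (Fin d → ℝ) → ℝ) (a ε : ℝ) (S : Set (Fin d → ℝ)) : Prop :=
  {x ∈ unitCube d | f x = a} ⊆ S ∧ S ⊆ {x ∈ unitCube d | |f x - a| ≤ ε}

/-- The `j`-th partial derivatives of `F`, collected into a vector of `Fin d → ℝ`. -/
noncomputable def gradVec (d : ℕ) (F : (Fin d → ℝ) → ℝ) (x : Fin d → ℝ) : Fin d → ℝ :=
  fun j => fderiv ℝ F x (Pi.single j 1)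

/-- `f` is `(c₁,γ₁)`-gradient-Hölder on `E`: it is the restriction to `E` of a `C¹` function
on `ℝ^d` whose gradient is `(c₁,γ₁)`-Hölder on `E` w.r.t. the sup-norm. -/
def GradHolderOn (d : ℕ) (c₁ γ₁ : ℝ) (E : Set (Fin d → ℝ)) (f : (Fin d → ℝ) → ℝ) : Prop :=
  ∃ F : (Fin d → ℝ) → ℝ, ContDiff ℝ 1 F ∧ Set.EqOn f F E ∧
    ∀ x ∈ E, ∀ y ∈ E, ‖gradVec d F x - gradVec d F y‖ ≤ c₁ * ‖x - y‖ ^ γ₁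

/-- The level set `{f = a}` is `Δ`-proper: it is nonempty, `min f + Δ ≤ a`, and
`a ≤ min_{∂[0,1]^d} f`. -/
def ProperLevelSet (d : ℕ) (f : (Fin d → ℝ) → ℝ) (a Δ : ℝ) : Prop :=
  (∃ x ∈ unitCube d, f x = a) ∧ (∃ x ∈ unitCube d, f x + Δ ≤ a) ∧
  ∀ x ∈ frontier (unitCube d), a ≤ f x

/-- test function -/
def tf (d : ℕ) (a K r : ℝ) (p : Fin d → ℝ) (x : Fin d → ℝ) : ℝ :=
  (∑ j, (x j - 1/2)^2) + (a - 1/4) + K * (max 0 (r^2 - ∑ j, (x j - p j)^2))^2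

lemma hasDerivAt_pp (s : ℝ) : HasDerivAt (fun s : ℝ => (max 0 s)^2) (2 * max 0 s) s := by
  rcases lt_trichotomy s 0 with h | h | h
  · rw [max_eq_left h.le, mul_zero]
    refine (hasDerivAt_const s (0:ℝ)).congr_of_eventuallyEq ?_
    filter_upwards [Iio_mem_nhds h] with y hy
    rw [max_eq_left (le_of_lt hy)]; simp
  · subst h
    rw [hasDerivAt_iff_isLittleO]
    simp only [max_self, mul_zero, sub_zero, smul_zero]
    have h2 : (fun x : ℝ => x ^ 2) =o[nhds 0] fun x : ℝ => x := by
      simpa using (Asymptotics.isLittleO_pow_id (𝕜 := ℝ) (n := 2) (by norm_num))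
    refine Asymptotics.IsBigO.trans_isLittleO ?_ h2
    refine Asymptotics.IsBigO.of_bound 1 (Filter.Eventually.of_forall fun x => ?_)
    rcases le_total 0 x with hx | hx
    · simp [max_eq_right hx]
    · simp [max_eq_left hx]; positivity
  · rw [max_eq_right h.le]
    have := (hasDerivAt_pow 2 s)
    refine HasDerivAt.congr_of_eventuallyEq (f := fun s : ℝ => s^2) (by simpa using this) ?_
    filter_upwards [Ioi_mem_nhds h] with y hy
    rw [max_eq_right (le_of_lt hy)]

lemma contDiff_pp : ContDiff ℝ 1 (fun s : ℝ => (max 0 s)^2) := by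
  rw [contDiff_one_iff_deriv]
  refine ⟨fun s => (hasDerivAt_pp s).differentiableAt, ?_⟩
  have : deriv (fun s : ℝ => (max 0 s)^2) = fun s => 2 * max 0 s :=
    funext fun s => (hasDerivAt_pp s).deriv
  rw [this]; fun_prop

lemma contDiff_tf (d : ℕ) (a K r : ℝ) (p : Fin d → ℝ) : ContDiff ℝ 1 (tf d a K r p) := by
  have h1 : ContDiff ℝ 1 (fun x : Fin d → ℝ => r^2 - ∑ j, (x j - p j)^2) := by fun_prop
  have h2 := contDiff_pp.comp h1
  have h3 : ContDiff ℝ 1 (fun x : Fin d → ℝ => (∑ j, (x j - 1/2)^2) + (a - 1/4)) := by fun_prop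
  exact h3.add (contDiff_const.mul h2)

lemma hasDerivAt_sq (d : ℕ) (p x : Fin d → ℝ) (j : Fin d) :
    HasDerivAt (fun t : ℝ => ∑ i, ((x + t • (Pi.single j (1:ℝ) : Fin d → ℝ)) i - p i)^2) (2 * (x j - p j)) 0 := by
  have : ∀ i ∈ Finset.univ, HasDerivAt (fun t : ℝ => ((x + t • (Pi.single j (1:ℝ) : Fin d → ℝ)) i - p i)^2)
      (if i = j then 2 * (x j - p j) else 0) 0 := by
    intro i _
    by_cases h : i = j
    · subst h
      have h1 : HasDerivAt (fun t : ℝ => x i + t - p i) 1 0 :=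
        ((hasDerivAt_id (0:ℝ)).const_add (x i)).sub_const (p i)
      have := h1.fun_pow 2
      simp only [Pi.add_apply, Pi.smul_apply, Pi.single_eq_same, smul_eq_mul, mul_one, if_true]
      exact this.congr_deriv (by simp)
    · simpa [h] using hasDerivAt_const (0:ℝ) ((x i - p i)^2)
  have h := HasDerivAt.fun_sum this
  simpa using h

lemma gradVec_tf (d : ℕ) (a K r : ℝ) (p x : Fin d → ℝ) (j : Fin d) :
    gradVec d (tf d a K r p) x j = 2 * (x j - 1/2)
      - 4 * K * (max 0 (r^2 - ∑ j, (x j - p j)^2) * (x j - p j)) := by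
  unfold gradVec
  have hd : DifferentiableAt ℝ (tf d a K r p) x :=
    ((contDiff_tf d a K r p).differentiable (by norm_num)) x
  rw [← hd.lineDeriv_eq_fderiv]
  have h1 := hasDerivAt_sq d p x j
  have h2 := (hasDerivAt_sq d (fun _ => 1/2) x j).add_const (a - 1/4)
  have h3 := h1.const_sub (r^2)
  have h4 := (HasDerivAt.comp (0:ℝ) (hasDerivAt_pp _) h3).const_mul K
  have h5 := h2.add h4
  have : HasLineDerivAt ℝ (tf d a K r p) _ x (Pi.single j 1) := h5
  rw [this.lineDeriv]
  simp
  ring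

lemma w_bound (d : ℕ) (hd : 1 ≤ d) (r : ℝ) (hr : 0 < r) (u v : Fin d → ℝ)
    (hu : ∑ j, u j ^2 ≤ r^2) :
    |max 0 (r^2 - ∑ j, u j^2) - max 0 (r^2 - ∑ j, v j^2)| ≤ 3 * d * r * ‖u - v‖ := by
  have hd' : (1:ℝ) ≤ d := by exact_mod_cast hd
  have hN := norm_nonneg (u - v)
  have huj : ∀ j, |u j| ≤ r := fun j => by
    apply abs_le_of_sq_le_sq _ hr.le
    exact (Finset.single_le_sum (f := fun j => u j ^2) (fun i _ => sq_nonneg _) (Finset.mem_univ j)).trans hu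
  have hs : 0 ≤ ∑ j, u j^2 := Finset.sum_nonneg fun i _ => sq_nonneg _
  have hs' : 0 ≤ ∑ j, v j^2 := Finset.sum_nonneg fun i _ => sq_nonneg _
  have hdj : ∀ j, |u j - v j| ≤ ‖u - v‖ := fun j => norm_le_pi_norm (u - v) j
  rcases le_total r ‖u - v‖ with h | h
  · have : |max 0 (r^2 - ∑ j, u j^2) - max 0 (r^2 - ∑ j, v j^2)| ≤ r^2 := by
      rw [abs_le]
      have h1 : max 0 (r^2 - ∑ j, u j^2) ≤ r^2 := max_le (by positivity) (by linarith)
      have h2 : max 0 (r^2 - ∑ j, v j^2) ≤ r^2 := max_le (by positivity) (by linarith)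
      have h3 := le_max_left 0 (r^2 - ∑ j, u j^2)
      have h4 := le_max_left 0 (r^2 - ∑ j, v j^2)
      constructor <;> linarith
    have h5 : r^2 ≤ r * ‖u-v‖ := by nlinarith
    have h6 : 0 ≤ r * ‖u-v‖ := by positivity
    nlinarith
  · have h1 : |max 0 (r^2 - ∑ j, u j^2) - max 0 (r^2 - ∑ j, v j^2)|
        ≤ |(r^2 - ∑ j, u j^2) - (r^2 - ∑ j, v j^2)| := by
      have := abs_max_sub_max_le_max 0 (r^2 - ∑ j, u j^2) 0 (r^2 - ∑ j, v j^2)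
      simpa using this
    refine h1.trans ?_
    have h2 : (r^2 - ∑ j, u j^2) - (r^2 - ∑ j, v j^2) = ∑ j, (v j^2 - u j^2) := by
      rw [Finset.sum_sub_distrib]; ring
    rw [h2]
    refine (Finset.abs_sum_le_sum_abs _ _).trans ?_
    have h3 : ∀ j ∈ Finset.univ, |v j^2 - u j^2| ≤ 3 * r * ‖u - v‖ := by
      intro j _
      have : v j^2 - u j^2 = -((u j - v j) * (2 * u j - (u j - v j))) := by ring
      rw [this, abs_neg, abs_mul]
      have h4 : |2 * u j - (u j - v j)| ≤ 3 * r := by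
        have h5 := abs_le.1 (huj j)
        have h6 := abs_le.1 (hdj j)
        rw [abs_le]; constructor <;> linarith
      calc _ ≤ ‖u - v‖ * (3 * r) := mul_le_mul (hdj j) h4 (abs_nonneg _) hN
        _ = _ := by ring
    refine (Finset.sum_le_sum h3).trans (le_of_eq ?_)
    simp; ring

lemma wu_bound' (d : ℕ) (hd : 1 ≤ d) (r : ℝ) (hr : 0 < r) (u v : Fin d → ℝ) (j : Fin d)
    (hu : ∑ j, u j ^2 ≤ r^2) :
    |max 0 (r^2 - ∑ j, u j^2) * u j - max 0 (r^2 - ∑ j, v j^2) * v j| ≤ 4 * d * r^2 * ‖u - v‖ := by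
  have hd' : (1:ℝ) ≤ d := by exact_mod_cast hd
  have hN := norm_nonneg (u - v)
  have h1 := w_bound d hd r hr u v hu
  have huj : |u j| ≤ r := by
    apply abs_le_of_sq_le_sq _ hr.le
    exact (Finset.single_le_sum (f := fun j => u j ^2) (fun i _ => sq_nonneg _) (Finset.mem_univ j)).trans hu
  have hdj : |u j - v j| ≤ ‖u - v‖ := norm_le_pi_norm (u - v) j
  have hs' : 0 ≤ ∑ j, v j^2 := Finset.sum_nonneg fun i _ => sq_nonneg _
  have h2 : max 0 (r^2 - ∑ j, v j^2) ≤ r^2 := max_le (by positivity) (by linarith)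
  have h4 := le_max_left 0 (r^2 - ∑ j, v j^2)
  set U := max 0 (r^2 - ∑ j, u j^2)
  set V := max 0 (r^2 - ∑ j, v j^2)
  have : U * u j - V * v j = (U - V) * u j + V * (u j - v j) := by ring
  rw [this]
  refine (abs_add_le _ _).trans ?_
  rw [abs_mul, abs_mul, abs_of_nonneg h4]
  have e1 : |U - V| * |u j| ≤ (3 * d * r * ‖u - v‖) * r :=
    mul_le_mul h1 huj (abs_nonneg _) (by positivity)
  have e2 : V * |u j - v j| ≤ r^2 * ‖u - v‖ := mul_le_mul h2 hdj (abs_nonneg _) (by positivity)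
  have e3 : 0 ≤ r^2 * ‖u - v‖ := by positivity
  nlinarith

lemma wu_bound (d : ℕ) (hd : 1 ≤ d) (r : ℝ) (hr : 0 < r) (u v : Fin d → ℝ) (j : Fin d) :
    |max 0 (r^2 - ∑ j, u j^2) * u j - max 0 (r^2 - ∑ j, v j^2) * v j| ≤ 4 * d * r^2 * ‖u - v‖ := by
  rcases le_total (∑ j, u j ^2) (r^2) with h | h
  · exact wu_bound' d hd r hr u v j h
  rcases le_total (∑ j, v j ^2) (r^2) with h' | h'
  · rw [abs_sub_comm, norm_sub_rev]
    exact wu_bound' d hd r hr v u j h'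
  rw [max_eq_left (by linarith), max_eq_left (by linarith)]
  simp only [zero_mul, sub_self, abs_zero]
  positivity

lemma gradHolder_tf (d : ℕ) (hd : 1 ≤ d) (a K r c₁ : ℝ) (hc : 3 ≤ c₁) (p : Fin d → ℝ)
    (hK : 0 ≤ K) (hr : 0 < r) (hKr : 16 * d * K * r^2 ≤ 1) (E : Set (Fin d → ℝ)) :
    GradHolderOn d c₁ 1 E (tf d a K r p) := by
  refine ⟨_, contDiff_tf d a K r p, fun _ _ => rfl, fun x _ y _ => ?_⟩
  rw [Real.rpow_one]
  have hN := norm_nonneg (x - y)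
  rw [pi_norm_le_iff_of_nonneg (by positivity)]
  intro j
  rw [Pi.sub_apply, gradVec_tf, gradVec_tf, Real.norm_eq_abs]
  have h1 := wu_bound d hd r hr (x - p) (y - p) j
  simp only [Pi.sub_apply, sub_sub_sub_cancel_right] at h1
  have hdj : |x j - y j| ≤ ‖x - y‖ := norm_le_pi_norm (x - y) j
  set U := max 0 (r^2 - ∑ j, (x j - p j)^2)
  set V := max 0 (r^2 - ∑ j, (y j - p j)^2)
  have e : 2 * (x j - 1/2) - 4 * K * (U * (x j - p j)) - (2 * (y j - 1/2) - 4 * K * (V * (y j - p j)))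
    = 2 * (x j - y j) - 4 * K * (U * (x j - p j) - V * (y j - p j)) := by ring
  rw [e]
  refine (abs_sub _ _).trans ?_
  rw [abs_mul, abs_mul, abs_of_nonneg (by norm_num : (0:ℝ) ≤ 2), abs_of_nonneg (by positivity : 0 ≤ 4 * K)]
  have e2 : 4 * K * |U * (x j - p j) - V * (y j - p j)| ≤ 4 * K * (4 * d * r^2 * ‖x - y‖) :=
    mul_le_mul_of_nonneg_left h1 (by positivity)
  have e3 : 16 * d * K * r^2 * ‖x - y‖ ≤ 1 * ‖x - y‖ := mul_le_mul_of_nonneg_right hKr hN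
  nlinarith

lemma convex_tf (d : ℕ) (hd : 1 ≤ d) (a K r : ℝ) (p : Fin d → ℝ)
    (hK : 0 ≤ K) (hr : 0 < r) (hKr : 16 * d * K * r^2 ≤ 1) :
    ConvexOn ℝ (unitCube d) (tf d a K r p) := by
  have hd' : (1:ℝ) ≤ d := by exact_mod_cast hd
  have hKr' : 2 * K * r^2 ≤ 1 := by
    have : 0 ≤ K * r^2 := by positivity
    nlinarith
  refine ⟨convex_Icc _ _, fun x _ y _ s t hs ht hst => ?_⟩
  obtain rfl : t = 1 - s := by linarith
  set X := ∑ j, (x j - p j)^2 with hX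
  set Y := ∑ j, (y j - p j)^2 with hY
  set D := ∑ j, (x j - y j)^2 with hD
  have hD0 : 0 ≤ D := Finset.sum_nonneg fun i _ => sq_nonneg _
  have key : ∀ q : Fin d → ℝ, ∑ j, ((s • x + (1-s) • y) j - q j)^2
      = s * ∑ j, (x j - q j)^2 + (1-s) * ∑ j, (y j - q j)^2 - s * (1-s) * D := by
    intro q
    rw [hD, Finset.mul_sum, Finset.mul_sum, Finset.mul_sum, ← Finset.sum_add_distrib,
      ← Finset.sum_sub_distrib]
    refine Finset.sum_congr rfl fun j _ => ?_
    simp only [Pi.add_apply, Pi.smul_apply, smul_eq_mul]; ring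
  have hZ0 : 0 ≤ ∑ j, ((s • x + (1-s) • y) j - p j)^2 := Finset.sum_nonneg fun i _ => sq_nonneg _
  unfold tf
  have k1 := key (fun _ => 1/2)
  have k2 := key p
  rw [k1]
  rw [← hX, ← hY] at k2 ⊢
  set Z := ∑ j, ((s • x + (1-s) • y) j - p j)^2
  simp only [smul_eq_mul]
  set A := max 0 (r^2 - X) with hA
  set B := max 0 (r^2 - Y) with hB
  set C := max 0 (r^2 - Z) with hC
  -- M = value at the convex combination of X,Y
  set M := max 0 (r^2 - (s * X + (1-s) * Y)) with hM
  have a0 : 0 ≤ A := le_max_left _ _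
  have b0 : 0 ≤ B := le_max_left _ _
  have m0 : 0 ≤ M := le_max_left _ _
  have a1 : r^2 - X ≤ A := le_max_right _ _
  have b1 : r^2 - Y ≤ B := le_max_right _ _
  have m1 : r^2 - (s * X + (1-s) * Y) ≤ M := le_max_right _ _
  have hsD : 0 ≤ s * (1-s) * D := by positivity
  have c1 : C ≤ r^2 := max_le (by positivity) (by linarith)
  have c2 : C ≤ M + s * (1-s) * D := max_le (by linarith) (by linarith)
  have c3 : M ≤ C := max_le_max le_rfl (by linarith)
  have m2 : M ≤ s * A + (1-s) * B := max_le (by positivity) (by nlinarith)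
  have m3 : M^2 ≤ s * A^2 + (1-s) * B^2 := by
    have : M^2 ≤ (s * A + (1-s) * B)^2 := pow_le_pow_left₀ m0 m2 2
    nlinarith [mul_nonneg (mul_nonneg hs ht) (sq_nonneg (A - B))]
  have c4 : C^2 - M^2 ≤ 2 * r^2 * (s * (1-s) * D) := by
    have : C^2 - M^2 = (C + M) * (C - M) := by ring
    rw [this]
    exact mul_le_mul (by linarith) (by linarith) (by linarith) (by positivity)
  have c5 : K * (C^2 - M^2) ≤ s * (1-s) * D := by
    calc _ ≤ K * (2 * r^2 * (s * (1-s) * D)) := mul_le_mul_of_nonneg_left c4 hK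
      _ = (2 * K * r^2) * (s * (1-s) * D) := by ring
      _ ≤ 1 * (s * (1-s) * D) := mul_le_mul_of_nonneg_right hKr' hsD
      _ = _ := one_mul _
  have c6 := mul_le_mul_of_nonneg_left m3 hK
  nlinarith

lemma proper_tf (d : ℕ) (hd : 1 ≤ d) (a K r : ℝ) (p : Fin d → ℝ)
    (hK : 0 ≤ K) (hr : r^2 ≤ 1/4) (hp : ∑ j, (p j - 1/2)^2 = 1/4) :
    ProperLevelSet d (tf d a K r p) a (1/4) := by
  have hcm : (fun _ => 1/2 : Fin d → ℝ) ∈ unitCube d :=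
    ⟨fun j => by norm_num, fun j => by norm_num⟩
  have hc : tf d a K r p (fun _ => 1/2) = a - 1/4 := by
    unfold tf
    have : ∑ j, ((1:ℝ)/2 - p j)^2 = 1/4 := by
      rw [← hp]; exact Finset.sum_congr rfl fun j _ => by ring
    rw [this, max_eq_left (by linarith)]; simp
  have hf : ∀ x ∈ frontier (unitCube d), a ≤ tf d a K r p x := by
    intro x hx
    have hx1 : x ∈ unitCube d := by
      have := frontier_subset_closure hx
      rwa [unitCube, isClosed_Icc.closure_eq] at this
    have hx2 : x ∉ interior (unitCube d) := hx.2
    rw [unitCube, ← Set.pi_univ_Icc, interior_pi_set Set.finite_univ] at hx2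
    simp only [interior_Icc, Set.mem_pi, not_forall] at hx2
    obtain ⟨j, _, hj⟩ := hx2
    have h0 := hx1.1 j
    have h1 := hx1.2 j
    simp only [Pi.zero_apply, Pi.one_apply, Set.mem_Ioo, not_and_or, not_lt] at h0 h1 hj
    have e : (1:ℝ)/4 ≤ (x j - 1/2)^2 := by
      rcases hj with h | h
      · have : x j = 0 := le_antisymm h h0
        rw [this]; norm_num
      · have : x j = 1 := le_antisymm h1 h
        rw [this]; norm_num
    have e2 := Finset.single_le_sum (f := fun j => (x j - 1/2)^2) (fun i _ => sq_nonneg _) (Finset.mem_univ j)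
    have e3 : 0 ≤ K * (max 0 (r^2 - ∑ j, (x j - p j)^2))^2 := by positivity
    unfold tf
    linarith
  refine ⟨?_, ⟨_, hcm, by rw [hc]; linarith⟩, hf⟩
  have h0m : (0 : Fin d → ℝ) ∈ unitCube d := ⟨le_rfl, fun j => by simp⟩
  have h0 : a ≤ tf d a K r p 0 := by
    have e3 : 0 ≤ K * (max 0 (r^2 - ∑ j, ((0 : Fin d → ℝ) j - p j)^2))^2 := by positivity
    have hd' : (1:ℝ) ≤ d := by exact_mod_cast hd
    unfold tf
    have : ∑ j : Fin d, ((0 : Fin d → ℝ) j - 1/2)^2 = (d : ℝ) * (1/4) := by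
      simp; norm_num
    rw [this]; linarith
  have hpc : IsPreconnected (unitCube d) := (convex_Icc (0 : Fin d → ℝ) 1).isPreconnected
  have := hpc.intermediate_value hcm h0m (contDiff_tf d a K r p).continuous.continuousOn
  obtain ⟨x, hx, hxa⟩ := this ⟨by rw [hc]; linarith, h0⟩
  exact ⟨x, hx, hxa⟩

lemma point_congr {d : ℕ} (A : Algorithm d) (f g : (Fin d → ℝ) → ℝ) (n : ℕ)
    (h : ∀ i < n, f (A.point f i) = g (A.point f i)) :
    ∀ i < n, A.point g i = A.point f i := by
  intro i
  induction i using Nat.strong_induction_on with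
  | _ i ih =>
    intro hi
    rw [Algorithm.point, Algorithm.point]
    congr 1
    funext k
    rw [ih k k.2 (k.2.trans hi), h k (k.2.trans hi)]

lemma output_congr {d : ℕ} (A : Algorithm d) (f g : (Fin d → ℝ) → ℝ) (n : ℕ)
    (h : ∀ i < n, f (A.point f i) = g (A.point f i)) :
    A.outputAfter g n = A.outputAfter f n := by
  unfold Algorithm.outputAfter
  congr 1
  funext k
  rw [point_congr A f g n h k k.2, h k k.2]

/-- centers -/
def ctr (e m : ℕ) (h : ℝ) (k : Fin e → Fin m) : Fin (e+1) → ℝ :=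
  Fin.cons (1/2 + Real.sqrt (1/4 - ∑ i, (h * (k i : ℕ))^2)) (fun i => 1/2 + h * (k i : ℕ))

lemma ctr_sum_le (e m : ℕ) (h : ℝ) (h0 : 0 ≤ h) (hm : m * h ≤ 1 / (2 * (e+1)))
    (k : Fin e → Fin m) : ∑ i, (h * (k i : ℕ))^2 ≤ 1/4 ∧ ∀ i, h * (k i : ℕ) ≤ 1/2 := by
  have hi : ∀ i, h * (k i : ℕ) ≤ 1 / (2 * (e+1)) := fun i => by
    refine le_trans ?_ hm
    rw [mul_comm]
    exact mul_le_mul_of_nonneg_right (by exact_mod_cast (k i).2.le) h0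
  have he : (1:ℝ) / (2 * (e+1)) ≤ 1/2 := by
    apply one_div_le_one_div_of_le (by norm_num); nlinarith [(Nat.cast_nonneg e : (0:ℝ) ≤ e)]
  refine ⟨?_, fun i => (hi i).trans he⟩
  have : ∀ i ∈ Finset.univ, (h * (k i : ℕ))^2 ≤ (1 / (2 * ((e:ℝ)+1)))^2 := fun i _ =>
    pow_le_pow_left₀ (by positivity) (hi i) 2
  refine (Finset.sum_le_sum this).trans ?_
  simp only [Finset.sum_const, Finset.card_univ, Fintype.card_fin, nsmul_eq_mul]
  rw [div_pow, ← mul_div_assoc, div_le_div_iff₀ (by positivity) (by norm_num)]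
  nlinarith [(Nat.cast_nonneg e : (0:ℝ) ≤ e)]

lemma ctr_sphere (e m : ℕ) (h : ℝ) (h0 : 0 ≤ h) (hm : m * h ≤ 1 / (2 * (e+1)))
    (k : Fin e → Fin m) : ∑ j, (ctr e m h k j - 1/2)^2 = 1/4 := by
  have := (ctr_sum_le e m h h0 hm k).1
  rw [Fin.sum_univ_succ]
  simp only [ctr, Fin.cons_zero, Fin.cons_succ, add_sub_cancel_left]
  rw [Real.sq_sqrt (by linarith)]; ring

lemma ctr_mem (e m : ℕ) (h : ℝ) (h0 : 0 ≤ h) (hm : m * h ≤ 1 / (2 * (e+1)))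
    (k : Fin e → Fin m) : ctr e m h k ∈ unitCube (e+1) := by
  have hs := ctr_sphere e m h h0 hm k
  have : ∀ j, |ctr e m h k j - 1/2| ≤ 1/2 := fun j => by
    apply abs_le_of_sq_le_sq _ (by norm_num)
    have := Finset.single_le_sum (f := fun j => (ctr e m h k j - 1/2)^2) (fun i _ => sq_nonneg _) (Finset.mem_univ j)
    linarith
  refine ⟨fun j => ?_, fun j => ?_⟩
  · have := (abs_le.1 (this j)).1
    simp only [Pi.zero_apply]; linarith
  · have := (abs_le.1 (this j)).2
    simp only [Pi.one_apply]; linarith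

lemma ctr_disj (e m : ℕ) (r : ℝ) (hr : 0 < r) (k l : Fin e → Fin m) (x : Fin (e+1) → ℝ)
    (hk : ∑ j, (x j - ctr e m (2*r) k j)^2 < r^2) (hl : ∑ j, (x j - ctr e m (2*r) l j)^2 < r^2) :
    k = l := by
  funext i
  have key : ∀ k : Fin e → Fin m, ∑ j, (x j - ctr e m (2*r) k j)^2 < r^2 →
      |x i.succ - (1/2 + 2 * r * (k i : ℕ))| < r := by
    intro k hk
    apply abs_lt_of_sq_lt_sq _ hr.le
    refine lt_of_le_of_lt ?_ hk
    have := Finset.single_le_sum (f := fun j => (x j - ctr e m (2*r) k j)^2) (fun i _ => sq_nonneg _) (Finset.mem_univ i.succ)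
    simpa [ctr] using this
  have h1 := abs_lt.1 (key k hk)
  have h2 := abs_lt.1 (key l hl)
  have h3 : ((k i : ℕ) : ℝ) < (l i : ℕ) + 1 := by nlinarith
  have h4 : ((l i : ℕ) : ℝ) < (k i : ℕ) + 1 := by nlinarith
  have h3' : (k i : ℕ) < (l i : ℕ) + 1 := by exact_mod_cast h3
  have h4' : (l i : ℕ) < (k i : ℕ) + 1 := by exact_mod_cast h4
  exact Fin.ext (by omega)

/-- Lower bound for convex gradient-Lipschitz functions: for `d ≥ 2` and
`c₁ ≥ 3` there is `κ > 0` (independent of `ε`) such that for every `ε > 0`, every positive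
`n < κ/ε^{(d-1)/2}` and every deterministic algorithm `A`, there is a convex
`c₁`-gradient-Lipschitz `f` with `(1/4)`-proper level set `{f = a}` such that the output
of `A` run on `f` after `n` queries is not an `ε`-approximation of `{f = a}`. -/
theorem stmt15 (d : ℕ) (hd : 2 ≤ d) (a c₁ : ℝ) (hc : 3 ≤ c₁) :
    ∃ κ : ℝ, 0 < κ ∧ ∀ ε : ℝ, 0 < ε → ∀ n : ℕ, 0 < n →
      (n : ℝ) < κ / ε ^ (((d : ℝ) - 1) / 2) →
      ∀ A : Algorithm d, ∃ f : (Fin d → ℝ) → ℝ,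
        ConvexOn ℝ (unitCube d) f ∧
        GradHolderOn d c₁ 1 (unitCube d) f ∧
        ProperLevelSet d f a (1 / 4) ∧
        ¬ IsEpsApprox d f a ε (A.outputAfter f n) := by
  obtain ⟨e, rfl⟩ : ∃ e, d = e + 1 := ⟨d - 1, by omega⟩
  have he : 1 ≤ e := by omega
  set D : ℝ := (e:ℝ) + 1 with hD
  have hD0 : 1 ≤ D := by rw [hD]; linarith [(Nat.cast_nonneg e : (0:ℝ) ≤ e)]
  refine ⟨(1 / (8 * D * Real.sqrt (32 * D)))^e, by positivity, ?_⟩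
  intro ε hε n hn hlt A
  set r := Real.sqrt (32 * D) * Real.sqrt ε with hr
  have hr0 : 0 < r := by positivity
  have hr2 : r^2 = 32 * D * ε := by
    rw [hr, mul_pow, Real.sq_sqrt (by positivity), Real.sq_sqrt hε.le]
  have hpow : ε ^ ((((e+1 : ℕ) : ℝ) - 1) / 2) = (Real.sqrt ε)^e := by
    rw [Real.sqrt_eq_rpow, ← Real.rpow_natCast, ← Real.rpow_mul hε.le]
    congr 1; push_cast; ring
  have hlt' : (n:ℝ) < (1 / (8 * D * r))^e := by
    rw [hpow, ← div_pow] at hlt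
    refine hlt.trans_eq ?_
    congr 1
    rw [hr, div_div]; ring
  have hbig : 1 < 1 / (8 * D * r) := by
    by_contra hcon
    have h1 : (1 / (8 * D * r))^e ≤ 1 := pow_le_one₀ (by positivity) (not_lt.1 hcon)
    have h2 : (1:ℝ) ≤ n := by exact_mod_cast hn
    linarith
  set m := ⌊1 / (4 * D * r)⌋₊ with hm
  have hhalf : 1 / (4 * D * r) = 2 * (1 / (8 * D * r)) := by field_simp; norm_num
  have hm1 : 1 / (8 * D * r) ≤ m := by
    have := Nat.lt_floor_add_one (1 / (4 * D * r))
    rw [← hm] at this; linarith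
  have hm2 : (m:ℝ) * (2 * r) ≤ 1 / (2 * ((e:ℝ)+1)) := by
    have : (m:ℝ) ≤ 1 / (4 * D * r) := Nat.floor_le (by positivity)
    calc _ ≤ 1 / (4 * D * r) * (2 * r) := mul_le_mul_of_nonneg_right this (by positivity)
      _ = _ := by rw [← hD]; field_simp; norm_num
  have hnm : n < m^e := by
    have : (n:ℝ) < (m:ℝ)^e := hlt'.trans_le (pow_le_pow_left₀ (by positivity) hm1 e)
    exact_mod_cast this
  have hrs : r^2 ≤ 1/4 := by
    rw [lt_div_iff₀ (by positivity)] at hbig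
    have : r ≤ 1/2 := by nlinarith
    nlinarith
  have h2r : 0 ≤ 2 * r := by positivity
  -- pigeonhole
  have hex : ∃ k : Fin e → Fin m, ∀ i : Fin n,
      r^2 ≤ ∑ j, (A.point (tf (e+1) a 0 r 0) i j - ctr e m (2*r) k j)^2 := by
    by_contra! hcon
    choose φ hφ using hcon
    have hinj : Function.Injective φ := by
      intro k l hkl
      have h1 := hφ k
      rw [hkl] at h1
      exact ctr_disj e m r hr0 k l _ h1 (hφ l)
    have := Fintype.card_le_of_injective φ hinj
    simp at this
    omega
  obtain ⟨k, hk⟩ := hex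
  set p := ctr e m (2*r) k with hp
  have hps : ∑ j, (p j - 1/2)^2 = 1/4 := ctr_sphere e m (2*r) h2r hm2 k
  have hpm : p ∈ unitCube (e+1) := ctr_mem e m (2*r) h2r hm2 k
  have hf0 : tf (e+1) a 0 r 0 = tf (e+1) a 0 r p := by
    funext x; simp [tf]
  rw [hf0] at hk
  set K : ℝ := 1 / (16 * D * r^2) with hK
  have hK0 : 0 < K := by positivity
  have hKr : 16 * ((e+1 : ℕ) : ℝ) * K * r^2 ≤ 1 := by
    apply le_of_eq
    push_cast
    rw [← hD, hK]; field_simp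
  by_cases h0 : IsEpsApprox (e+1) (tf (e+1) a 0 r p) a ε (A.outputAfter (tf (e+1) a 0 r p) n)
  · refine ⟨tf (e+1) a K r p, convex_tf _ (by omega) a K r p hK0.le hr0 hKr,
      gradHolder_tf _ (by omega) a K r c₁ hc p hK0.le hr0 hKr _,
      proper_tf _ (by omega) a K r p hK0.le hrs hps, fun h1 => ?_⟩
    rw [output_congr A (tf (e+1) a 0 r p) (tf (e+1) a K r p) n] at h1
    · have hpS := h0.1 (show p ∈ {x ∈ unitCube (e+1) | tf (e+1) a 0 r p x = a} from
        ⟨hpm, by unfold tf; rw [hps]; ring⟩)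
      have h2 := (h1.2 hpS).2
      have h3 : tf (e+1) a K r p p = a + 2 * ε := by
        unfold tf
        rw [hps]
        have : K * (max 0 (r^2 - ∑ j, (p j - p j)^2))^2 = 2 * ε := by
          simp only [sub_self]
          simp
          rw [max_eq_right (by positivity), hK, hr2]; field_simp; norm_num
        rw [this]; ring
      rw [h3, add_sub_cancel_left, abs_of_pos (by positivity)] at h2
      linarith
    · intro i hi
      have := hk ⟨i, hi⟩
      simp only at this
      unfold tf at this ⊢
      rw [max_eq_left (sub_nonpos.2 this)]; simp
  · exact ⟨tf (e+1) a 0 r p, convex_tf _ (by omega) a 0 r p le_rfl hr0 (by simp),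
      gradHolder_tf _ (by omega) a 0 r c₁ hc p le_rfl hr0 (by simp) _,
      proper_tf _ (by omega) a 0 r p le_rfl hrs hps, h0⟩
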